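/- arXiv:0708.0817 — 2 statements merged into one kernel-verified Lean document; each statement's English description precedes it below -/
import Mathlib

section
/- Let G be abelian of exponent 2 and order 2^m with character group Ĝ, and let 𝒮 = ⊕_{χ∈Ĝ} ℤe_χ be the maximal order of ℚ[G]. If 𝓔/F is a multi-quadratic extension of totally real fields, then Ann_{ℤ[G]}(W_2(𝓔))·𝒮 = w_2(F)ℤe_{χ₀} ⊕ ⊕_{χ≠χ₀} w_2(E_χ)^- ℤe_χ, where w_2(E_χ)^- = |W_2(E_χ)_{1+τ_χ}|. -/
set_option maxHeartbeats 1000000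
set_option synthInstance.maxHeartbeats 400000

/- Common abstract framework for formalizing results of
   J.W. Sands, "Values at s = -1 of L-functions for multi-quadratic extensions
   of number fields, and the Fitting ideal of the tame kernel".

   Objects not available in Mathlib (the S-tame kernel `K₂(O^S)`, the equivariant
   L-value `θ^S(-1)`, Dedekind zeta values) are carried as abstract data together
   with hypotheses expressing their defining properties. -/

open scoped BigOperators Classical
noncomputable section
namespace Sands

/-- A number field is totally real if every infinite place is real. -/
def IsTotallyRealField (F : Type) [Field F] [NumberField F] : Prop :=
  ∀ v : NumberField.InfinitePlace F, v.IsReal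

/-- `W₂(L)` for a subfield `L ⊆ ℂ`: the roots of unity `z` fixed by the square of every
automorphism of `ℂ` over `L`. -/
def W2set (L : Subfield ℂ) : Set ℂ :=
  {z : ℂ | (∃ n : ℕ, n ≠ 0 ∧ z ^ n = 1) ∧ ∀ γ : ℂ ≃ₐ[L] ℂ, γ (γ z) = z}

/-- `w₂(L) = |W₂(L)|`. -/
def w2 (L : Subfield ℂ) : ℕ := Nat.card (W2set L)

/-- `t` is a Galois conjugate of `2·cos(2π/2^{m+2})` for some `m ≥ 0`, i.e. a generator of
a layer of the cyclotomic `ℤ₂`-extension of `ℚ`: there is a chain `x₀ = 0`,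
`x_{i+1}² = x_i + 2`, ending at `t`. -/
def IsTwoPowerCosine (t : ℂ) : Prop :=
  ∃ (n : ℕ) (x : ℕ → ℂ), x 0 = 0 ∧ (∀ i < n, x (i + 1) * x (i + 1) = x i + 2) ∧ x n = t

/-- `F^{(1)} ⊆ E`, where `F^{(1)}` denotes the first layer of the cyclotomic
`ℤ₂`-extension of `F` (for `E/F` quadratic this says exactly `E = F^{(1)}`). -/
def ContainsFirstLayer (F E : Set ℂ) : Prop :=
  ∃ t : ℂ, t ∈ E ∧ t ∉ F ∧ IsTwoPowerCosine t

/-- Data for the Birch–Tate conjecture for a totally real field `L` and a set `S` of primes: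
the zeta value `ζ_L^S(-1)`, the cardinality `|S|`, `|K₂(O_L^S)|` and `w₂(L)`. -/
structure BTData where
  zeta : ℚ
  cardS : ℕ
  k2 : ℕ
  w2 : ℕ

/-- The Birch–Tate equation `ζ_L^S(-1) = (-1)^{|S|}·|K₂(O_L^S)|/w₂(L)`. -/
def BTData.Holds (d : BTData) : Prop :=
  d.zeta = (-1 : ℚ) ^ d.cardS * (d.k2 : ℚ) / (d.w2 : ℚ)

variable (G : Type) [CommGroup G]

/-- The coefficient-extension ring homomorphism `ℤ[G] →+* ℚ[G]`. -/
def ratMap : MonoidAlgebra ℤ G →+* MonoidAlgebra ℚ G :=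
  MonoidAlgebra.liftNCRingHom
    (MonoidAlgebra.singleOneRingHom.comp (Int.castRingHom ℚ))
    (MonoidAlgebra.of ℚ G) fun _ _ => Commute.all _ _

/-- The first Fitting ideal of a module `M` over a commutative ring `R`: the ideal generated
by all determinants of square relation matrices of finite generating families of `M`. -/
def fittingIdeal (R M : Type) [CommRing R] [AddCommGroup M] [Module R M] : Ideal R :=
  Ideal.span {d : R | ∃ (n : ℕ) (g : Fin n → M) (A : Matrix (Fin n) (Fin n) R),
    Submodule.span R (Set.range g) = ⊤ ∧ (∀ i, ∑ j, A i j • g j = 0) ∧ d = A.det}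

variable [Fintype G]

/-- The idempotent `e_χ = |G|⁻¹ ∑_σ χ(σ) σ⁻¹ ∈ ℚ[G]` attached to a (real-valued)
character `χ` of `G`. -/
def idem (χ : G →* ℚˣ) : MonoidAlgebra ℚ G :=
  (Fintype.card G : ℚ)⁻¹ • ∑ σ : G, ((χ σ : ℚ) • MonoidAlgebra.of ℚ G σ⁻¹)

/-- The maximal order `𝒮 = ⊕_χ ℤ e_χ` of `ℚ[G]` (for `G` of exponent 2), as a
`ℤ`-submodule of `ℚ[G]`. -/
def maxOrder : Submodule ℤ (MonoidAlgebra ℚ G) :=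
  Submodule.span ℤ (Set.range (idem G))

/-- The image of an ideal `I ⊆ ℤ[G]` in `ℚ[G]`, as a `ℤ`-submodule. -/
def imageInQ (I : Ideal (MonoidAlgebra ℤ G)) : Submodule ℤ (MonoidAlgebra ℚ G) :=
  Submodule.span ℤ (ratMap G '' I)

/-- The extension `I·𝒮` of an ideal `I ⊆ ℤ[G]` to the maximal order `𝒮`. -/
def extToMax (I : Ideal (MonoidAlgebra ℤ G)) : Submodule ℤ (MonoidAlgebra ℚ G) :=
  Submodule.span ℤ {z : MonoidAlgebra ℚ G | ∃ s ∈ maxOrder G, ∃ a ∈ I, z = s * ratMap G a}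

/-- The extension `I·ℤ[1/2][G]` of an ideal `I ⊆ ℤ[G]` to `ℤ[1/2][G] ⊆ ℚ[G]`. -/
def extToHalf (I : Ideal (MonoidAlgebra ℤ G)) : Submodule ℤ (MonoidAlgebra ℚ G) :=
  Submodule.span ℤ
    {z : MonoidAlgebra ℚ G | ∃ (n : ℕ), ∃ a ∈ I, z = ((2 : ℚ) ^ n)⁻¹ • ratMap G a}

/-- The extension `I·𝒮[1/2]` of an ideal `I ⊆ ℤ[G]` to `𝒮[1/2] = ℤ[1/2][G]`. -/
def extToMaxHalf (I : Ideal (MonoidAlgebra ℤ G)) : Submodule ℤ (MonoidAlgebra ℚ G) :=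
  Submodule.span ℤ {z : MonoidAlgebra ℚ G |
    ∃ s ∈ maxOrder G, ∃ (n : ℕ), ∃ a ∈ I, z = ((2 : ℚ) ^ n)⁻¹ • (s * ratMap G a)}

/-- The `𝒮`-ideal generated by a single element `g ∈ ℚ[G]`. -/
def genMaxIdeal (g : MonoidAlgebra ℚ G) : Submodule ℤ (MonoidAlgebra ℚ G) :=
  Submodule.span ℤ {z : MonoidAlgebra ℚ G | ∃ s ∈ maxOrder G, z = s * g}

/-- The `𝒮[1/2]`-ideal generated by a single element `g ∈ ℚ[G]`. -/
def genMaxHalfIdeal (g : MonoidAlgebra ℚ G) : Submodule ℤ (MonoidAlgebra ℚ G) :=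
  Submodule.span ℤ
    {z : MonoidAlgebra ℚ G | ∃ s ∈ maxOrder G, ∃ n : ℕ, z = ((2 : ℚ) ^ n)⁻¹ • (s * g)}

/-- `2·N` for a `ℤ`-submodule `N`. -/
def double {M : Type} [AddCommGroup M] [Module ℤ M] (N : Submodule ℤ M) : Submodule ℤ M :=
  N.map ((2 : ℤ) • (LinearMap.id : M →ₗ[ℤ] M))

/-- The value `χ(σ) = ±1` of a real-valued character, as an element of `ℤ[G]`. -/
def sgn (χ : G →* ℚˣ) (σ : G) : MonoidAlgebra ℤ G := if χ σ = 1 then 1 else -1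

/-- The ideal `I_χ = ker(ℤ[G] → ℤe_χ)`, generated by the elements `σ - χ(σ)`. -/
def charIdeal (χ : G →* ℚˣ) : Ideal (MonoidAlgebra ℤ G) :=
  Ideal.span {x | ∃ σ : G, x = MonoidAlgebra.of ℤ G σ - sgn G χ σ}

/-- The index `(ℤ[G] : I)` of an ideal of `ℤ[G]`. -/
def idx (I : Ideal (MonoidAlgebra ℤ G)) : ℕ := I.toAddSubgroup.index


/-- `w₂fixed G W`: the order of the `G`-fixed points of `W`; for `W = W₂(𝓔)` and
`G = Gal(𝓔/F)` this is `w₂(F)`. -/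
def w2fixed (G : Type) [CommGroup G] (W : Type) [AddCommGroup W]
    [Module (MonoidAlgebra ℤ G) W] : ℕ :=
  Nat.card {w : W | ∀ σ : G, MonoidAlgebra.of ℤ G σ • w = w}

/-- `w2minus G W χ τ`: the order of the subgroup of `W` fixed by `ker χ` and annihilated by
`1 + τ`; for `W = W₂(𝓔)` this is `w₂(E_χ)⁻ = |W₂(E_χ)_{1+τ_χ}|`. -/
def w2minus (G : Type) [CommGroup G] (W : Type) [AddCommGroup W]
    [Module (MonoidAlgebra ℤ G) W] (χ : G →* ℚˣ) (τ : G) : ℕ :=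
  Nat.card {w : W | (∀ σ : G, χ σ = 1 → MonoidAlgebra.of ℤ G σ • w = w) ∧
    (1 + MonoidAlgebra.of ℤ G τ) • w = 0}

/-- The image `M^α` of a `ℤ[G]`-module `M` under multiplication by `α ∈ ℤ[G]`. -/
def imageOf (G : Type) [CommGroup G] (M : Type) [AddCommGroup M]
    [Module (MonoidAlgebra ℤ G) M] (α : MonoidAlgebra ℤ G) :
    Submodule (MonoidAlgebra ℤ G) M :=
  LinearMap.range (LinearMap.lsmul (MonoidAlgebra ℤ G) M α)

section CharacterEvaluation

variable {Γ : Type} [CommGroup Γ]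

/-- A rational-valued character of a group of exponent 2 takes values in `{1, -1}`. -/
lemma char_eq_one_or_neg_one (hexp : ∀ g : Γ, g * g = 1) (χ : Γ →* ℚˣ) (σ : Γ) :
    χ σ = 1 ∨ χ σ = -1 := by
  have h : χ σ * χ σ = 1 := by rw [← map_mul, hexp, map_one]
  have h' : (χ σ : ℚ) * χ σ = 1 := by
    rw [← Units.val_mul, h, Units.val_one]
  rcases mul_self_eq_one_iff.mp h' with h1 | h1
  · exact Or.inl (Units.ext h1)
  · exact Or.inr (Units.ext h1)

/-- A rational-valued character of a group of exponent 2 factors through `ℤ`. -/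
lemma exists_int_char (hexp : ∀ g : Γ, g * g = 1) (χ : Γ →* ℚˣ) :
    ∃ ψ : Γ →* ℤ, ∀ σ, (ψ σ : ℚ) = χ σ := by
  have hval : ∀ σ, (((χ σ : ℚ).num : ℤ) : ℚ) = χ σ := fun σ ↦ by
    rcases char_eq_one_or_neg_one hexp χ σ with h | h <;> simp [h]
  refine ⟨⟨⟨fun σ ↦ (χ σ : ℚ).num, by simp⟩, fun σ ρ ↦ ?_⟩, hval⟩
  have : ((((χ (σ * ρ) : ℚ).num : ℤ)) : ℚ) = (((χ σ : ℚ).num * (χ ρ : ℚ).num : ℤ) : ℚ) := by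
    rw [Int.cast_mul, hval, hval, hval, map_mul, Units.val_mul]
  exact_mod_cast this

lemma ratMap_single (σ : Γ) (k : ℤ) :
    ratMap Γ (MonoidAlgebra.single σ k) = (k : ℚ) • MonoidAlgebra.of ℚ Γ σ := by
  have h : ratMap Γ (MonoidAlgebra.single σ k) =
      MonoidAlgebra.single 1 (k : ℚ) * MonoidAlgebra.of ℚ Γ σ :=
    MonoidAlgebra.liftNC_single _ _ _ _
  rw [h, MonoidAlgebra.of_apply, MonoidAlgebra.single_mul_single, MonoidAlgebra.smul_single,
    one_mul, mul_one, smul_eq_mul, mul_one]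

variable [Fintype Γ]

lemma idem_mul_of (χ : Γ →* ℚˣ) (σ : Γ) :
    idem Γ χ * MonoidAlgebra.of ℚ Γ σ = (χ σ : ℚ) • idem Γ χ := by
  unfold idem
  rw [smul_mul_assoc, smul_comm (χ σ : ℚ), Finset.sum_mul,
    Finset.smul_sum (r := (χ σ : ℚ))]
  congr 1
  refine Fintype.sum_equiv (Equiv.mulLeft σ⁻¹) _ _ fun t ↦ ?_
  rw [smul_mul_assoc, ← map_mul, smul_smul, Equiv.coe_mulLeft, ← Units.val_mul, ← map_mul]
  simp [mul_comm]

/-- `ℤ[Γ]` acts on `e_χ` through the evaluation at `χ`. -/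
lemma idem_mul_ratMap (χ : Γ →* ℚˣ) (ψ : Γ →* ℤ) (hψ : ∀ σ, (ψ σ : ℚ) = χ σ)
    (a : MonoidAlgebra ℤ Γ) :
    idem Γ χ * ratMap Γ a = ((MonoidAlgebra.lift ℤ ℤ Γ ψ a : ℤ) : ℚ) • idem Γ χ := by
  induction a using MonoidAlgebra.induction_linear with
  | zero => simp
  | add f g hf hg => rw [map_add, mul_add, hf, hg, map_add, Int.cast_add, add_smul]
  | single σ k =>
    rw [ratMap_single, mul_smul_comm, idem_mul_of, smul_smul, MonoidAlgebra.lift_single,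
      smul_eq_mul, Int.cast_mul, hψ]

end CharacterEvaluation

/-- In a finite cyclic group the number of elements killed by a divisor `d` of the order
is `d`. -/
lemma card_nsmul_eq_zero_of_dvd (W : Type) [AddCommGroup W] [Finite W] [IsAddCyclic W] {d : ℕ}
    (hd : d ∣ Nat.card W) : Nat.card {w : W | d • w = 0} = d :=
  (IsAddCyclic.card_nsmulAddMonoidHom_ker W d).trans (Nat.gcd_eq_right hd)

section CyclicModule

variable {Γ W : Type} [CommGroup Γ] [AddCommGroup W] [Module (MonoidAlgebra ℤ Γ) W]

/-- The image of `Ann_{ℤ[Γ]}(W)` under a character `ψ` is generated by the order of the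
`ψ`-eigenspace of the finite cyclic module `W`. -/
lemma map_annihilator_eq_span_card [Finite W] [IsAddCyclic W] (ψ : Γ →* ℤ) :
    (Module.annihilator (MonoidAlgebra ℤ Γ) W).map (MonoidAlgebra.lift ℤ ℤ Γ ψ) =
      Ideal.span {(Nat.card {w : W | ∀ σ, MonoidAlgebra.of ℤ Γ σ • w = ψ σ • w} : ℤ)} := by
  set φ := MonoidAlgebra.lift ℤ ℤ Γ ψ with hφ
  have hφint : ∀ k : ℤ, φ (k : MonoidAlgebra ℤ Γ) = k := fun k ↦ by simp
  have hsurj : Function.Surjective φ := fun k ↦ ⟨k, hφint k⟩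
  obtain ⟨d₀, hd₀⟩ := (IsPrincipalIdealRing.principal
    ((Module.annihilator (MonoidAlgebra ℤ Γ) W).map φ)).principal
  obtain ⟨d, hd⟩ : ∃ d : ℕ, (Module.annihilator (MonoidAlgebra ℤ Γ) W).map φ =
      Ideal.span {(d : ℤ)} := ⟨d₀.natAbs, by rw [hd₀, Int.span_natAbs]⟩
  have hmem : ∀ a ∈ Module.annihilator (MonoidAlgebra ℤ Γ) W, (d : ℤ) ∣ φ a := fun a ha ↦
    Ideal.mem_span_singleton.mp (hd ▸ Ideal.mem_map_of_mem φ ha)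
  have hdn : d ∣ Nat.card W := by
    have h := hmem ((Nat.card W : ℤ) : MonoidAlgebra ℤ Γ) (Module.mem_annihilator.mpr fun w ↦ by
      rw [Int.cast_smul_eq_zsmul, natCast_zsmul, card_nsmul_eq_zero'])
    rw [hφint] at h
    exact_mod_cast h
  have hset : {w : W | ∀ σ, MonoidAlgebra.of ℤ Γ σ • w = ψ σ • w} = {w : W | d • w = 0} := by
    ext w
    constructor
    · intro hw
      obtain ⟨a, ha, had⟩ := (Ideal.mem_map_iff_of_surjective φ hsurj).mp
        (hd ▸ Ideal.mem_span_singleton_self (d : ℤ))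
      have key : ∀ b : MonoidAlgebra ℤ Γ, b • w = φ b • w := fun b ↦ by
        induction b using MonoidAlgebra.induction_linear with
        | zero => simp
        | add f g hf hg => rw [add_smul, hf, hg, map_add, add_smul]
        | single σ k =>
          have : MonoidAlgebra.single σ k =
              (k : MonoidAlgebra ℤ Γ) * MonoidAlgebra.of ℤ Γ σ := by
            rw [← zsmul_eq_mul]; simp
          rw [this, mul_smul, hw σ, map_mul, hφint, Int.cast_smul_eq_zsmul, smul_smul, hφ,
            MonoidAlgebra.lift_of]
      have := key a
      rwa [had, Module.mem_annihilator.mp ha, natCast_zsmul, eq_comm] at this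
    · intro hw σ
      obtain ⟨g, hg⟩ := IsAddCyclic.exists_generator (α := W)
      obtain ⟨k, hk⟩ := AddSubgroup.mem_zmultiples_iff.mp (hg (MonoidAlgebra.of ℤ Γ σ • g))
      have hσ : ∀ v : W, MonoidAlgebra.of ℤ Γ σ • v = k • v := fun v ↦ by
        obtain ⟨l, rfl⟩ := AddSubgroup.mem_zmultiples_iff.mp (hg v)
        rw [smul_comm, ← hk, smul_comm]
      obtain ⟨c, hc⟩ := hmem (MonoidAlgebra.of ℤ Γ σ - (k : MonoidAlgebra ℤ Γ))
        (Module.mem_annihilator.mpr fun v ↦ by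
          rw [sub_smul, hσ, Int.cast_smul_eq_zsmul, sub_self])
      rw [map_sub, hφint, hφ, MonoidAlgebra.lift_of] at hc
      have hw' : (d : ℤ) • w = 0 := by rw [natCast_zsmul]; exact hw
      rw [hσ, sub_eq_iff_eq_add.mp hc, add_smul, mul_comm, mul_smul, hw', smul_zero, zero_add]
  rw [hd, hset, card_nsmul_eq_zero_of_dvd W hdn]

lemma w2fixed_eq_card_eigenspace (ψ : Γ →* ℤ) (hψ : ∀ σ, ψ σ = 1) :
    w2fixed Γ W = Nat.card {w : W | ∀ σ, MonoidAlgebra.of ℤ Γ σ • w = ψ σ • w} := by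
  simp only [w2fixed, hψ, one_smul]

lemma w2minus_eq_card_eigenspace (hexp : ∀ g : Γ, g * g = 1) (χ : Γ →* ℚˣ) (ψ : Γ →* ℤ)
    (hψ : ∀ σ, (ψ σ : ℚ) = χ σ) {τ : Γ} (hτ : χ τ ≠ 1) :
    w2minus Γ W χ τ = Nat.card {w : W | ∀ σ, MonoidAlgebra.of ℤ Γ σ • w = ψ σ • w} := by
  have hτ' : χ τ = -1 := (char_eq_one_or_neg_one hexp χ τ).resolve_left hτ
  have hone : ∀ σ, χ σ = 1 → ψ σ = 1 := fun σ h ↦ by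
    have := hψ σ
    rw [h, Units.val_one] at this
    exact_mod_cast this
  have hneg : ∀ σ, χ σ = -1 → ψ σ = -1 := fun σ h ↦ by
    have := hψ σ
    rw [h, Units.val_neg, Units.val_one] at this
    exact_mod_cast this
  unfold w2minus
  congr 2
  ext w
  simp only [Set.mem_ofPred_eq, add_smul, one_smul]
  constructor
  · rintro ⟨hker, hanti⟩ σ
    rcases char_eq_one_or_neg_one hexp χ σ with h | h
    · rw [hone σ h, one_smul, hker σ h]
    · have hστ : χ (σ * τ) = 1 := by rw [map_mul, h, hτ', neg_one_mul, neg_neg]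
      have hfix := hker _ hστ
      rw [map_mul, mul_smul, eq_neg_of_add_eq_zero_right hanti, smul_neg] at hfix
      rw [hneg σ h, neg_one_smul, ← neg_eq_iff_eq_neg, hfix]
  · intro h
    refine ⟨fun σ hσ ↦ by rw [h, hone σ hσ, one_smul], ?_⟩
    rw [h, hneg τ hτ', neg_one_smul, add_neg_cancel]

end CyclicModule

/-- **Proposition 3.5** (extension of `Ann_{ℤ[G]}(W₂(𝓔))` to the maximal order `𝒮`).
`𝓔/F` is a multi-quadratic extension of totally real number fields with Galois group `Γ`
of exponent 2 and order `2^m`, `X` is the set of all characters of `Γ` and, for `χ ≠ 1`,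
`τ χ ∉ ker χ`.  `W` is the (finite, cyclic) `ℤ[Γ]`-module `W₂(𝓔)`, so that
`w₂(F) = |W^Γ|` and `w₂(E_χ)⁻ = |W₂(E_χ)_{1+τ_χ}|` where `W₂(E_χ) = W^{ker χ}`.  Then
`Ann_{ℤ[Γ]}(W₂(𝓔))·𝒮 = w₂(F) ℤe_{χ₀} ⊕ ⊕_{χ≠χ₀} w₂(E_χ)⁻ ℤe_χ`. -/
theorem stmt6
    (F : Subfield ℂ) [NumberField F] (hFtr : IsTotallyRealField F)
    (𝓔 : IntermediateField F ℂ) [NumberField 𝓔] [FiniteDimensional F 𝓔] [IsGalois F 𝓔]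
    (h𝓔tr : IsTotallyRealField 𝓔)
    (Γ : Type) [CommGroup Γ] [Fintype Γ] (gal : Γ ≃* (𝓔 ≃ₐ[F] 𝓔))
    (hexp : ∀ g : Γ, g * g = 1) (m : ℕ) (hcard : Fintype.card Γ = 2 ^ m)
    (X : Finset (Γ →* ℚˣ)) (hX : ∀ χ, χ ∈ X)
    (τ : (Γ →* ℚˣ) → Γ) (hτ : ∀ χ ∈ X, χ ≠ 1 → χ (τ χ) ≠ 1)
    -- W = W₂(𝓔), a finite cyclic ℤ[Γ]-module of order w₂(𝓔) with W^Γ of order w₂(F)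
    (W : Type) [AddCommGroup W] [Module (MonoidAlgebra ℤ Γ) W] [Finite W] [IsAddCyclic W]
    (hWcard : Nat.card W = w2 𝓔.toSubfield) (hWF : w2fixed Γ W = w2 F) :
    extToMax Γ (Module.annihilator (MonoidAlgebra ℤ Γ) W) =
      Submodule.span ℤ {z : MonoidAlgebra ℚ Γ | ∃ χ ∈ X,
        z = (if χ = 1 then (w2 F : ℚ) else (w2minus Γ W χ (τ χ) : ℚ)) • idem Γ χ} := by
  have hint : ∀ (k : ℤ) (z : MonoidAlgebra ℚ Γ), (k : ℚ) • z = k • z := fun k z ↦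
    Int.cast_smul_eq_zsmul ℚ k z
  have hcoef : ∀ χ : Γ →* ℚˣ, ∃ c : ℤ,
      (if χ = 1 then (w2 F : ℚ) else (w2minus Γ W χ (τ χ) : ℚ)) = c ∧
      (∀ a ∈ Module.annihilator (MonoidAlgebra ℤ Γ) W, ∃ k : ℤ,
        idem Γ χ * ratMap Γ a = k • (c : ℚ) • idem Γ χ) ∧
      ∃ a ∈ Module.annihilator (MonoidAlgebra ℤ Γ) W,
        (c : ℚ) • idem Γ χ = idem Γ χ * ratMap Γ a := by
    intro χ
    obtain ⟨ψ, hψ⟩ := exists_int_char hexp χ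
    have hmap := map_annihilator_eq_span_card (W := W) ψ
    have hsurj : Function.Surjective (MonoidAlgebra.lift ℤ ℤ Γ ψ) := fun k ↦ ⟨k, by simp⟩
    refine ⟨Nat.card {w : W | ∀ σ, MonoidAlgebra.of ℤ Γ σ • w = ψ σ • w}, ?_,
      fun a ha ↦ ?_, ?_⟩
    · split_ifs with h
      · rw [← hWF, w2fixed_eq_card_eigenspace ψ fun σ ↦ by
          have := hψ σ
          rw [h, MonoidHom.one_apply, Units.val_one] at this
          exact_mod_cast this]
        norm_cast
      · rw [w2minus_eq_card_eigenspace hexp χ ψ hψ (hτ χ (hX χ) h)]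
        norm_cast
    · obtain ⟨k, hk⟩ := Ideal.mem_span_singleton.mp (hmap ▸ Ideal.mem_map_of_mem _ ha)
      refine ⟨k, ?_⟩
      rw [idem_mul_ratMap χ ψ hψ, hk, ← hint, smul_smul, mul_comm, Int.cast_mul]
    · obtain ⟨a, ha, hac⟩ := (Ideal.mem_map_iff_of_surjective _ hsurj).mp
        (hmap ▸ Ideal.mem_span_singleton_self _)
      exact ⟨a, ha, by rw [idem_mul_ratMap χ ψ hψ, hac]⟩
  apply le_antisymm
  · refine Submodule.span_le.mpr ?_
    rintro _ ⟨s, hs, a, ha, rfl⟩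
    induction hs using Submodule.span_induction with
    | mem _ h =>
      obtain ⟨χ, rfl⟩ := h
      obtain ⟨c, hc, hdvd, -⟩ := hcoef χ
      obtain ⟨k, hk⟩ := hdvd a ha
      rw [hk, ← hc]
      exact Submodule.smul_mem _ k (Submodule.subset_span ⟨χ, hX χ, rfl⟩)
    | zero => rw [zero_mul]; exact Submodule.zero_mem _
    | add x y _ _ hx hy => rw [add_mul]; exact Submodule.add_mem _ hx hy
    | smul k x _ hx => rw [smul_mul_assoc]; exact Submodule.smul_mem _ k hx
  · refine Submodule.span_le.mpr ?_
    rintro _ ⟨χ, -, rfl⟩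
    obtain ⟨c, hc, -, a, ha, hca⟩ := hcoef χ
    rw [hc, hca]
    exact Submodule.subset_span ⟨_, Submodule.subset_span ⟨χ, rfl⟩, a, ha, rfl⟩

end Sands
end
end

section
/- Let p^t be a positive power of a prime and E a totally real number field, and write ω_{p^t} for a primitive p^t-th root of unity. If p is odd, then p^t divides w_2(E) if and only if ω_{p^t} + ω_{p^t}^{-1} ∈ E. If p = 2, then 2^t divides w_2(E) if and only if ω_{2^{t-1}} + ω_{2^{t-1}}^{-1} ∈ E. -/
set_option maxHeartbeats 1000000
set_option synthInstance.maxHeartbeats 400000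

/- Common abstract framework for formalizing results of
   J.W. Sands, "Values at s = -1 of L-functions for multi-quadratic extensions
   of number fields, and the Fitting ideal of the tame kernel".

   Objects not available in Mathlib (the S-tame kernel `K₂(O^S)`, the equivariant
   L-value `θ^S(-1)`, Dedekind zeta values) are carried as abstract data together
   with hypotheses expressing their defining properties. -/

open scoped BigOperators Classical
noncomputable section
namespace Sands

variable (G : Type) [CommGroup G]

variable [Fintype G]

/-- Every automorphism of a field extends to any algebraically closed extension. -/
theorem exists_ringEquiv_extending {A K : Type*} [Field A] [Field K] [Algebra A K]
    [IsAlgClosed K] (σ : A ≃+* A) :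
    ∃ τ : K ≃+* K, ∀ a, τ (algebraMap A K a) = algebraMap A K (σ a) := by
  obtain ⟨s, hs⟩ := exists_isTranscendenceBasis A K
  let := IsAlgClosed.isAlgClosure_of_transcendence_basis _ hs
  let v := hs.1.aevalEquiv
  let e : Algebra.adjoin A (Set.range ((↑) : s → K)) ≃+*
      Algebra.adjoin A (Set.range ((↑) : s → K)) :=
    v.symm.toRingEquiv.trans ((MvPolynomial.mapEquiv s σ).trans v.toRingEquiv)
  refine ⟨IsAlgClosure.equivOfEquiv K K e, fun a ↦ ?_⟩
  have he : e (algebraMap A _ a) = algebraMap A _ (σ a) := by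
    change v (MvPolynomial.map _ (v.symm (algebraMap A _ a))) = _
    rw [AlgEquiv.commutes, MvPolynomial.algebraMap_eq, MvPolynomial.map_C,
      ← MvPolynomial.algebraMap_eq]
    exact v.commutes _
  rw [IsScalarTower.algebraMap_apply A (Algebra.adjoin A (Set.range ((↑) : s → K))) K,
    IsAlgClosure.equivOfEquiv_algebraMap, he, ← IsScalarTower.algebraMap_apply]

/-- An algebraic element of an algebraically closed extension of a perfect field `F` that is
fixed by all automorphisms over `F` lies in `F`. -/
theorem mem_range_algebraMap_of_forall_algEquiv_eq {F K : Type*} [Field F] [PerfectField F]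
    [Field K] [Algebra F K] [IsAlgClosed K] {x : K} (hx : IsAlgebraic F x)
    (h : ∀ γ : K ≃ₐ[F] K, γ x = x) : x ∈ Set.range (algebraMap F K) := by
  let A := algebraicClosure F K
  have hxA : x ∈ A := mem_algebraicClosure_iff.mpr hx
  have hfix : ∀ σ : A ≃ₐ[F] A, σ ⟨x, hxA⟩ = ⟨x, hxA⟩ := by
    intro σ
    obtain ⟨τ, hτ⟩ := exists_ringEquiv_extending (K := K) σ.toRingEquiv
    have hτF : ∀ a : F, τ (algebraMap F K a) = algebraMap F K a := fun a ↦ by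
      simpa [← IsScalarTower.algebraMap_apply] using hτ (algebraMap F A a)
    exact Subtype.ext ((hτ _).symm.trans (h (AlgEquiv.ofRingEquiv hτF)))
  obtain ⟨a, ha⟩ := (InfiniteGalois.mem_range_algebraMap_iff_fixed _).mpr hfix
  exact ⟨a, congrArg Subtype.val ha⟩

theorem prime_pow_dvd_two_mul_sub_or_add {p s : ℕ} (hp : p.Prime) {a : ℤ}
    (h : (p ^ s : ℤ) ∣ (a - 1) * (a + 1)) :
    (p ^ s : ℤ) ∣ 2 * (a - 1) ∨ (p ^ s : ℤ) ∣ 2 * (a + 1) := by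
  have hpI := Nat.prime_iff_prime_int.mp hp
  have key : ∀ {x y : ℤ}, (p ^ s : ℤ) ∣ x * y → ¬ (p : ℤ) ∣ y → (p ^ s : ℤ) ∣ x :=
    fun hxy hy ↦ ((Prime.coprime_iff_not_dvd hpI).mpr hy).pow_left.dvd_of_dvd_mul_right hxy
  by_cases h₁ : (p : ℤ) ∣ a - 1
  · by_cases h₂ : (p : ℤ) ∣ a + 1
    · have h2 : (p : ℤ) ∣ 2 := by simpa using (by ring : a + 1 - (a - 1) = 2) ▸ dvd_sub h₂ h₁
      obtain rfl : p = 2 := (Nat.prime_dvd_prime_iff_eq hp Nat.prime_two).mp (by exact_mod_cast h2)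
      obtain ⟨b, hb⟩ := h₁
      obtain rfl : a = 2 * b + 1 := by push_cast at hb; omega
      rcases Int.even_or_odd b with hb' | hb'
      · left
        refine key (y := b + 1) (h.trans (dvd_of_eq (by ring))) ?_
        have := Int.even_iff.mp hb'
        push_cast
        omega
      · right
        refine key (y := b) (h.trans (dvd_of_eq (by ring))) ?_
        have := Int.odd_iff.mp hb'
        push_cast
        omega
    · exact .inl ((key h h₂).mul_left _)
  · exact .inr ((key ((mul_comm _ _).subst h) h₁).mul_left _)

/-- The group of units underlying `W2set L`. -/
def W2subgroup (L : Subfield ℂ) : Subgroup ℂˣ where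
  carrier := {u | (u : ℂ) ∈ W2set L}
  one_mem' := ⟨⟨1, by simp⟩, by simp⟩
  mul_mem' := by
    rintro u v ⟨⟨m, hm, hu⟩, hu'⟩ ⟨⟨n, hn, hv⟩, hv'⟩
    refine ⟨⟨m * n, mul_ne_zero hm hn, ?_⟩, fun γ ↦ by simp [hu', hv']⟩
    rw [Units.val_mul, mul_pow, pow_mul, hu, mul_comm m n, pow_mul, hv]
    simp
  inv_mem' := by
    rintro u ⟨⟨m, hm, hu⟩, hu'⟩
    exact ⟨⟨m, hm, by simp [hu]⟩, fun γ ↦ by simp [hu']⟩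

theorem ne_zero_of_mem_W2set {L : Subfield ℂ} {z : ℂ} (hz : z ∈ W2set L) : z ≠ 0 := by
  rintro rfl
  obtain ⟨⟨n, hn, h⟩, -⟩ := hz
  simp [hn] at h

theorem pow_mem_W2set {L : Subfield ℂ} {z : ℂ} (hz : z ∈ W2set L) (k : ℕ) : z ^ k ∈ W2set L :=
  (W2subgroup L).pow_mem (x := Units.mk0 z (ne_zero_of_mem_W2set hz)) hz k

theorem card_W2subgroup (L : Subfield ℂ) : Nat.card (W2subgroup L) = w2 L :=
  Nat.card_congr
    { toFun u := ⟨u.1, u.2⟩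
      invFun z := ⟨Units.mk0 z.1 (ne_zero_of_mem_W2set z.2), z.2⟩
      left_inv _ := by ext; rfl
      right_inv _ := rfl }

theorem sq_add_inv_sq_mem_of_mem_W2set {L : Subfield ℂ} {p t : ℕ} (hp : p.Prime) {z : ℂ}
    (hzt : z ^ p ^ t = 1) (hz : z ∈ W2set L) : z ^ 2 + (z ^ 2)⁻¹ ∈ L := by
  have hint : IsIntegral L z := ⟨Polynomial.X ^ p ^ t - 1,
    Polynomial.monic_X_pow_sub_C _ (pow_pos hp.pos t).ne', by simp [hzt]⟩
  have halg : IsAlgebraic L (z ^ 2 + (z ^ 2)⁻¹) :=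
    (hint.isAlgebraic.pow 2).add (hint.isAlgebraic.pow 2).inv
  obtain ⟨s, -, hs⟩ := (Nat.dvd_prime_pow hp).mp (orderOf_dvd_of_pow_eq_one hzt)
  have hprim : IsPrimitiveRoot z (p ^ s) := hs ▸ IsPrimitiveRoot.orderOf z
  have hz0 := ne_zero_of_mem_W2set hz
  have : NeZero (p ^ s) := ⟨(pow_pos hp.pos s).ne'⟩
  suffices ∀ γ : ℂ ≃ₐ[L] ℂ, γ (z ^ 2 + (z ^ 2)⁻¹) = z ^ 2 + (z ^ 2)⁻¹ by
    obtain ⟨a, ha⟩ := mem_range_algebraMap_of_forall_algEquiv_eq halg this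
    exact ha ▸ a.2
  intro γ
  obtain ⟨a, -, ha⟩ := hprim.eq_pow_of_pow_eq_one
    (show γ z ^ p ^ s = 1 by rw [← map_pow, hprim.pow_eq_one, map_one])
  have hdvd : (p ^ s : ℤ) ∣ ((a : ℤ) - 1) * (a + 1) := by
    have haa : z ^ (a * a) = z := by
      rw [pow_mul, ha, ← map_pow, ha, hz.2 γ]
    have : z ^ (((a : ℤ) - 1) * (a + 1)) = 1 := by
      rw [show ((a : ℤ) - 1) * (a + 1) = ((a * a : ℕ) : ℤ) - 1 by push_cast; ring,
        zpow_sub₀ hz0, zpow_natCast, haa, zpow_one, div_self hz0]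
    exact_mod_cast (hprim.zpow_eq_one_iff_dvd _).mp this
  rw [map_add, map_inv₀, map_pow, ← ha, ← pow_mul]
  have hor := prime_pow_dvd_two_mul_sub_or_add hp hdvd
  rw [← Nat.cast_pow] at hor
  rcases hor with h | h
  · have h1 := (hprim.zpow_eq_one_iff_dvd _).mpr h
    rw [show 2 * ((a : ℤ) - 1) = ((a * 2 : ℕ) : ℤ) - (2 : ℕ) by push_cast; ring,
      zpow_sub₀ hz0, zpow_natCast, zpow_natCast, div_eq_one_iff_eq (pow_ne_zero _ hz0)] at h1
    rw [h1]
  · have h1 := (hprim.zpow_eq_one_iff_dvd _).mpr h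
    rw [show 2 * ((a : ℤ) + 1) = ((a * 2 : ℕ) : ℤ) + (2 : ℕ) by push_cast; ring,
      zpow_add₀ hz0, zpow_natCast, zpow_natCast] at h1
    rw [eq_inv_of_mul_eq_one_left h1, inv_inv, add_comm]

theorem mem_W2set_of_add_inv_mem {L : Subfield ℂ} {w z : ℂ} (hw : w ≠ 0) (hL : w + w⁻¹ ∈ L)
    {n k : ℕ} (hn : n ≠ 0) (hzn : z ^ n = 1) (hzw : z ^ 2 = w ^ k) : z ∈ W2set L := by
  refine ⟨⟨n, hn, hzn⟩, fun γ ↦ ?_⟩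
  have hz0 : z ≠ 0 := by
    rintro rfl
    simp [hn] at hzn
  have hγ : γ w + (γ w)⁻¹ = w + w⁻¹ := by
    rw [← map_inv₀, ← map_add]
    exact γ.commutes ⟨_, hL⟩
  have hγw : γ w ≠ 0 := (map_ne_zero γ).mpr hw
  have hor : γ w = w ∨ γ w = w⁻¹ := by
    have : (γ w - w) * (γ w - w⁻¹) = 0 := by
      field_simp at hγ ⊢
      linear_combination hγ
    simpa [sub_eq_zero] using this
  have hsq : γ z ^ 2 = z ^ 2 ∨ γ z ^ 2 = z⁻¹ ^ 2 := by
    rw [← map_pow, inv_pow, hzw, map_pow]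
    rcases hor with h | h <;> simp [h]
  rcases hsq with h | h <;> rcases sq_eq_sq_iff_eq_or_eq_neg.mp h with h | h <;> simp [h]

open Polynomial in
theorem prime_pow_le_of_mem_W2set {L : Subfield ℂ} [NumberField L] {p k : ℕ} (hp : p.Prime)
    {z : ℂ} (hprim : IsPrimitiveRoot z (p ^ k)) (hz : z ∈ W2set L) :
    p ^ k ≤ 8 * Module.finrank ℚ L := by
  have hd : 0 < Module.finrank ℚ L := Module.finrank_pos
  rcases Nat.eq_zero_or_pos k with rfl | hk
  · simp only [pow_zero]
    omega
  have hpos : 0 < p ^ k := pow_pos hp.pos k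
  have hz0 := ne_zero_of_mem_W2set hz
  let c : L := ⟨_, sq_add_inv_sq_mem_of_mem_W2set hp hprim.pow_eq_one hz⟩
  let f : L[X] := X ^ 4 - C c * X ^ 2 + 1
  have hfdeg : f.natDegree ≤ 4 := by unfold f; compute_degree
  have hf0 : f ≠ 0 := fun h ↦ by
    have : f.coeff 0 = 1 := by simp [f, coeff_X_pow]
    simp [h] at this
  have hfz : aeval z f = 0 := by
    have hc : algebraMap L ℂ c = z ^ 2 + (z ^ 2)⁻¹ := rfl
    simp only [f, map_add, map_sub, map_mul, map_pow, aeval_X, aeval_C, map_one, hc]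
    field_simp
    ring
  have hint : IsIntegral L z := (isAlgebraic_iff_isIntegral).mp ⟨f, hf0, hfz⟩
  have h4 : Module.finrank L (IntermediateField.adjoin L {z}) ≤ 4 := by
    rw [IntermediateField.adjoin.finrank hint]
    exact (natDegree_le_of_dvd (minpoly.dvd _ _ hfz) hf0).trans hfdeg
  have := IntermediateField.adjoin.finiteDimensional hint
  have : FiniteDimensional ℚ (IntermediateField.adjoin L {z}) := FiniteDimensional.trans ℚ L _
  have htot : Nat.totient (p ^ k) ≤ Module.finrank ℚ (IntermediateField.adjoin L {z}) := by
    rw [← natDegree_cyclotomic (p ^ k) ℚ, cyclotomic_eq_minpoly_rat hprim hpos]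
    have := minpoly.natDegree_le (A := ℚ) (IntermediateField.AdjoinSimple.gen L z)
    rwa [← minpoly.algebraMap_eq (algebraMap (IntermediateField.adjoin L {z}) ℂ).injective,
      IntermediateField.AdjoinSimple.algebraMap_gen] at this
  rw [← Module.finrank_mul_finrank ℚ L] at htot
  have hle : p ^ k ≤ 2 * Nat.totient (p ^ k) := by
    obtain ⟨j, rfl⟩ := Nat.exists_eq_add_of_lt hk
    rw [Nat.totient_prime_pow hp hk]
    have := hp.two_le
    simp only [zero_add, Nat.add_sub_cancel, pow_succ]
    nlinarith [Nat.mul_le_mul_left (p ^ j) (show p ≤ 2 * (p - 1) by omega)]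
  nlinarith [Nat.mul_le_mul_left (Module.finrank ℚ L) h4]

theorem finite_W2set (L : Subfield ℂ) [NumberField L] : (W2set L).Finite := by
  let N := (8 * Module.finrank ℚ L).factorial
  refine (Polynomial.nthRootsFinset N (1 : ℂ)).finite_toSet.subset fun z hz ↦ ?_
  rw [Finset.mem_coe, Polynomial.mem_nthRootsFinset (Nat.factorial_pos _),
    ← orderOf_dvd_iff_pow_eq_one, Nat.dvd_iff_prime_pow_dvd_dvd]
  intro p k hp hpk
  obtain ⟨⟨n, hn, hzn⟩, -⟩ := id hz
  have ho : 0 < orderOf z :=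
    Nat.pos_of_dvd_of_pos (orderOf_dvd_of_pow_eq_one hzn) (Nat.pos_of_ne_zero hn)
  obtain ⟨m, hm⟩ := hpk
  have hprim := (IsPrimitiveRoot.orderOf z).pow ho (hm.trans (mul_comm _ _))
  exact Nat.dvd_factorial (pow_pos hp.pos k)
    (prime_pow_le_of_mem_W2set hp hprim (pow_mem_W2set hz m))

theorem dvd_w2_iff_mem_W2set {L : Subfield ℂ} [NumberField L] {n : ℕ} {ω : ℂ}
    (hω : IsPrimitiveRoot ω n) : n ∣ w2 L ↔ ω ∈ W2set L := by
  rw [← card_W2subgroup]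
  constructor
  · intro h
    have : Finite (W2set L) := finite_W2set L
    have : Finite (W2subgroup L) := Nat.finite_of_card_ne_zero <| by
      rw [card_W2subgroup]
      have : Nonempty (W2set L) := ⟨⟨1, (W2subgroup L).one_mem⟩⟩
      exact Nat.card_pos.ne'
    obtain ⟨g, hg⟩ := IsCyclic.exists_ofOrder_eq_natCard (α := W2subgroup L)
    have hgprim : IsPrimitiveRoot ((g : ℂˣ) : ℂ) (Nat.card (W2subgroup L)) := by
      rw [← hg, ← Subgroup.orderOf_coe, ← orderOf_units]
      exact IsPrimitiveRoot.orderOf _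
    have : NeZero (Nat.card (W2subgroup L)) := ⟨Nat.card_pos.ne'⟩
    obtain ⟨i, -, hi⟩ := hgprim.eq_pow_of_pow_eq_one ((hω.pow_eq_one_iff_dvd _).mpr h)
    exact hi ▸ pow_mem_W2set g.2 i
  · intro h
    let g : W2subgroup L := ⟨Units.mk0 ω (ne_zero_of_mem_W2set h), h⟩
    have : orderOf g = n := by
      rw [← Subgroup.orderOf_coe, ← orderOf_units, hω.eq_orderOf]
      rfl
    exact this ▸ orderOf_dvd_natCard g

/-- **Lemma 3.11**.  Let `p^t` be a positive power of a prime and `E ⊆ ℂ` a totally real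
number field, and let `ω` be a primitive `p^t`-th root of unity.  If `p` is odd then
`p^t ∣ w₂(E) ↔ ω + ω⁻¹ ∈ E`; if `p = 2` then, for a primitive `2^{t-1}`-st root of
unity `ω'`, `2^t ∣ w₂(E) ↔ ω' + ω'⁻¹ ∈ E`. -/
theorem stmt10 (p t : ℕ) (hp : p.Prime) (ht : 0 < t)
    (E : Subfield ℂ) [NumberField E] (hEtr : IsTotallyRealField E)
    (ω : ℂ) (hω : IsPrimitiveRoot ω (p ^ t)) :
    (Odd p → (p ^ t ∣ w2 E ↔ ω + ω⁻¹ ∈ E)) ∧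
    (p = 2 → ∀ ω' : ℂ, IsPrimitiveRoot ω' (2 ^ (t - 1)) →
      (2 ^ t ∣ w2 E ↔ ω' + ω'⁻¹ ∈ E)) := by
  have hn : 0 < p ^ t := pow_pos hp.pos t
  rw [dvd_w2_iff_mem_W2set hω]
  refine ⟨fun hodd ↦ ⟨fun h ↦ ?_, fun h ↦ ?_⟩, ?_⟩
  · obtain ⟨m, hm⟩ := hodd.pow (n := t)
    have hsq : (ω ^ (m + 1)) ^ 2 = ω := by
      rw [← pow_mul, show (m + 1) * 2 = p ^ t + 1 by omega, pow_succ, hω.pow_eq_one, one_mul]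
    have := sq_add_inv_sq_mem_of_mem_W2set hp (t := t) (z := ω ^ (m + 1))
      (by rw [pow_right_comm, hω.pow_eq_one, one_pow]) (pow_mem_W2set h _)
    rwa [hsq] at this
  · exact mem_W2set_of_add_inv_mem (hω.ne_zero hn.ne') h hn.ne' hω.pow_eq_one rfl
  · rintro rfl ω' hω'
    rw [dvd_w2_iff_mem_W2set hω]
    have hsucc : 2 * 2 ^ (t - 1) = 2 ^ t := by rw [← pow_succ', Nat.sub_add_cancel ht]
    have hn' : 2 ^ (t - 1) ≠ 0 := by positivity
    have : NeZero (2 ^ (t - 1)) := ⟨hn'⟩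
    have hω2 : IsPrimitiveRoot (ω ^ 2) (2 ^ (t - 1)) := hω.pow hn hsucc.symm
    refine ⟨fun h ↦ ?_, fun h ↦ ?_⟩
    · obtain ⟨i, -, hi⟩ := hω2.eq_pow_of_pow_eq_one hω'.pow_eq_one
      have := sq_add_inv_sq_mem_of_mem_W2set hp (t := t) (z := ω ^ i)
        (by rw [pow_right_comm, hω.pow_eq_one, one_pow]) (pow_mem_W2set h _)
      rwa [pow_right_comm, hi] at this
    · obtain ⟨k, -, hk⟩ := hω'.eq_pow_of_pow_eq_one hω2.pow_eq_one
      exact mem_W2set_of_add_inv_mem (hω'.ne_zero hn') h hn.ne' hω.pow_eq_one hk.symm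

end Sands
end
end
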